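/- Let T > 0, ρ ∈ (0,1), χ = ρ(1−ρ), ψ ∈ C²_c(ℝ), H ∈ C^{1,2}_c([0,T]×ℝ), and let μ be defined by μ(t,u) = ∫_ℝ p_t(u−v) ψ(v) dv − χ ∫₀ᵗ ∫_ℝ p'_{t−s}(u−v) ∂_v H(s,v) dv ds for 0 < t ≤ T, with μ(0,·) = ψ. Then for every Schwartz function f on ℝ and all 0 ≤ s ≤ t ≤ T, writing E = ( ∫₀ᵀ∫_ℝ (∂_u H(r,u))² du dr )^{1/2}, one has |∫_ℝ (μ(t,u) − μ(s,u)) f(u) du| ≤ ((t−s)/2) ‖f''‖_{L²(ℝ)} ‖ψ‖_{L²(ℝ)} + χ √(t−s) ‖f'‖_{L²(ℝ)} E + (χ/2)(t−s) √T ‖f'''‖_{L²(ℝ)} E. -/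

import Mathlib

open Real MeasureTheory

/-- The one-dimensional heat kernel `p_t(u) = (2πt)^{-1/2} exp(-u²/(2t))`. -/
noncomputable def heatK (t u : ℝ) : ℝ := Real.exp (-(u ^ 2) / (2 * t)) / Real.sqrt (2 * π * t)

/-- The spatial derivative of the heat kernel: `p'_t(u) = -(u/t) p_t(u)`. -/
noncomputable def heatK' (t u : ℝ) : ℝ := -(u / t) * heatK t u

section Aux
open ProbabilityTheory

lemma aux_cs {α : Type*} [MeasurableSpace α] {m : Measure α} {f g : α → ℝ}
    (hf : MemLp f 2 m) (hg : MemLp g 2 m) :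
    |∫ a, f a * g a ∂m| ≤ Real.sqrt (∫ a, f a ^ 2 ∂m) * Real.sqrt (∫ a, g a ^ 2 ∂m) := by
  have h2 : (ENNReal.ofReal 2) = 2 := by simp
  have h := integral_mul_norm_le_Lp_mul_Lq (μ := m) (f := f) (g := g) Real.HolderConjugate.two_two
    (by rwa [h2]) (by rwa [h2])
  have h1 : |∫ a, f a * g a ∂m| ≤ ∫ a, ‖f a‖ * ‖g a‖ ∂m := by
    refine (norm_integral_le_integral_norm (μ := m) (fun a => f a * g a)).trans (le_of_eq ?_)
    simp only [norm_mul]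
  refine h1.trans (h.trans (le_of_eq ?_))
  simp only [Real.sqrt_eq_rpow, Real.rpow_two, Real.norm_eq_abs, sq_abs]

/-- second order Taylor bound -/
lemma aux_taylor {C C1 C2 : ℝ → ℝ} {M : ℝ} (h1 : ∀ x, HasDerivAt C (C1 x) x)
    (h2 : ∀ x, HasDerivAt C1 (C2 x) x) (hM : ∀ x, |C2 x| ≤ M) (x y : ℝ) :
    |C (x + y) - C x - y * C1 x| ≤ M * y ^ 2 / 2 := by
  have key : ∀ (D D1 D2 : ℝ → ℝ), (∀ x, HasDerivAt D (D1 x) x) → (∀ x, HasDerivAt D1 (D2 x) x) →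
      (∀ x, |D2 x| ≤ M) → ∀ y, 0 ≤ y → |D y - D 0 - y * D1 0| ≤ M * y ^ 2 / 2 := by
    intro D D1 D2 h1 h2 hM y hy
    have hL : ∀ z, 0 ≤ z → |D1 z - D1 0| ≤ M * z := by
      intro z hz
      have := image_norm_le_of_norm_deriv_right_le_deriv_boundary (f := fun z => D1 z - D1 0)
        (f' := D2) (a := 0) (b := z) (B := fun z => M * z) (B' := fun _ => M)
        (fun w _ => ((h2 w).sub_const _).continuousAt.continuousWithinAt)
        (fun w _ => ((h2 w).sub_const _).hasDerivWithinAt) (by simp)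
        (fun w => by simpa using (hasDerivAt_id w).const_mul M)
        (fun w _ => hM w) (x := z) ⟨hz, le_rfl⟩
      simpa using this
    have hd : ∀ w, HasDerivAt (fun z => D z - D 0 - z * D1 0) (D1 w - D1 0) w := by
      intro w
      exact (((h1 w).sub_const (D 0)).sub ((hasDerivAt_id w).mul_const (D1 0))).congr_deriv (by simp)
    have := image_norm_le_of_norm_deriv_right_le_deriv_boundary (f := fun z => D z - D 0 - z * D1 0)
        (f' := fun w => D1 w - D1 0) (a := 0) (b := y) (B := fun z => M * z ^ 2 / 2)
        (B' := fun z => M * z)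
        (fun w _ => (hd w).continuousAt.continuousWithinAt)
        (fun w _ => (hd w).hasDerivWithinAt) (by simp)
        (fun w => by
          have := ((hasDerivAt_pow 2 w).const_mul M).div_const 2
          refine this.congr_deriv ?_
          norm_num; ring)
        (fun w hw => hL w hw.1) (x := y) ⟨hy, le_rfl⟩
    simpa using this
  rcases le_total 0 y with hy | hy
  · have := key (fun z => C (x + z)) (fun z => C1 (x + z)) (fun z => C2 (x + z))
      (fun z => by simpa using (h1 (x + z)).comp_const_add x z)
      (fun z => by simpa using (h2 (x + z)).comp_const_add x z) (fun z => hM _) y hy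
    simpa using this
  · have := key (fun z => C (x - z)) (fun z => -C1 (x - z)) (fun z => C2 (x - z))
      (fun z => by simpa using (h1 (x - z)).comp_const_sub x z)
      (fun z => ((h2 (x - z)).comp_const_sub x z).neg.congr_deriv (by simp)) (fun z => hM _) (-y) (by linarith)
    simpa using this

/-- time regularity of Gaussian expectations -/
lemma aux_gauss {C C1 C2 : ℝ → ℝ} {M B : ℝ} (h1 : ∀ x, HasDerivAt C (C1 x) x)
    (h2 : ∀ x, HasDerivAt C1 (C2 x) x) (hM : ∀ x, |C2 x| ≤ M) (hB : ∀ x, |C x| ≤ B)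
    (s d : NNReal) :
    |∫ x, C x ∂(gaussianReal 0 (s + d)) - ∫ x, C x ∂(gaussianReal 0 s)| ≤ d / 2 * M := by
  have hCc : Continuous C := continuous_iff_continuousAt.2 fun x => (h1 x).continuousAt
  have hC1c : Continuous C1 := continuous_iff_continuousAt.2 fun x => (h2 x).continuousAt
  have hInteg : ∀ (m : Measure ℝ) [IsProbabilityMeasure m], Integrable C m := fun m _ =>
    Integrable.of_bound hCc.aestronglyMeasurable B (Filter.Eventually.of_forall hB)
  have hid : Integrable (fun y : ℝ => y) (gaussianReal 0 d) := by
    have := (memLp_id_gaussianReal (μ := 0) (v := d) 1)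
    exact (memLp_one_iff_integrable (f := id)).1 (by simpa using this)
  have hsq : Integrable (fun y : ℝ => y ^ 2) (gaussianReal 0 d) := by
    have := (memLp_id_gaussianReal (μ := 0) (v := d) 2)
    exact MemLp.integrable_sq (f := id) (by simpa using this)
  have hsqv : ∫ y, y ^ 2 ∂(gaussianReal 0 d) = d := by
    have := variance_id_gaussianReal (μ := 0) (v := d)
    rw [variance_eq_integral (by fun_prop)] at this
    simpa using this
  have e1 : gaussianReal 0 (s + d) = (gaussianReal 0 s) ∗ (gaussianReal 0 d) := by
    rw [gaussianReal_conv_gaussianReal]; simp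
  have hCi : ∀ x, Integrable (fun y => C (x + y)) (gaussianReal 0 d) := fun x =>
    Integrable.of_bound (by fun_prop) B (Filter.Eventually.of_forall fun y => hB _)
  have e2 : ∀ x, ∫ y, C (x + y) ∂(gaussianReal 0 d) - C x
      = ∫ y, (C (x + y) - C x - y * C1 x) ∂(gaussianReal 0 d) := by
    intro x
    have hCx : Integrable (fun y => C (x + y) - C x) (gaussianReal 0 d) :=
      (hCi x).sub (integrable_const _)
    rw [integral_sub hCx (hid.mul_const _),
      integral_sub (hCi x) (integrable_const _), integral_mul_const, integral_id_gaussianReal]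
    simp
  have hb : ∀ x, |∫ y, C (x + y) ∂(gaussianReal 0 d) - C x| ≤ d / 2 * M := by
    intro x
    rw [e2]
    have : |∫ y, (C (x + y) - C x - y * C1 x) ∂(gaussianReal 0 d)| ≤
        ∫ y, M * y ^ 2 / 2 ∂(gaussianReal 0 d) :=
      norm_integral_le_of_norm_le (f := fun y => C (x + y) - C x - y * C1 x) ((hsq.const_mul M).div_const 2)
        (Filter.Eventually.of_forall fun y => aux_taylor h1 h2 hM x y)
    refine this.trans (le_of_eq ?_)
    rw [integral_div, integral_const_mul, hsqv]; ring
  rw [e1, integral_conv (hInteg _)]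
  have hInteg2 : Integrable (fun x => ∫ y, C (x + y) ∂(gaussianReal 0 d)) (gaussianReal 0 s) := by
    have : Integrable (fun q : ℝ × ℝ => C (q.1 + q.2)) ((gaussianReal 0 s).prod (gaussianReal 0 d)) :=
      Integrable.of_bound (by fun_prop) B (Filter.Eventually.of_forall fun y => hB _)
    exact this.integral_prod_left
  rw [← integral_sub hInteg2 (hInteg _)]
  have := norm_integral_le_of_norm_le_const (μ := gaussianReal 0 s)
    (f := fun x => ∫ y, C (x + y) ∂(gaussianReal 0 d) - C x) (C := d / 2 * M)
    (Filter.Eventually.of_forall hb)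
  simpa using this

noncomputable def auxCorr (g f : ℝ → ℝ) (x : ℝ) : ℝ := ∫ v, g v * f (v + x)

lemma aux_schwartz_bdd (f : SchwartzMap ℝ ℝ) : ∃ B, ∀ x, |f x| ≤ B := by
  obtain ⟨B, hB⟩ := f.decay 0 0
  exact ⟨B, fun x => by simpa using hB.2 x⟩

noncomputable def auxD (f : SchwartzMap ℝ ℝ) : SchwartzMap ℝ ℝ := SchwartzMap.derivCLM ℝ ℝ f

lemma auxD_coe (f : SchwartzMap ℝ ℝ) : (auxD f : ℝ → ℝ) = deriv f := by
  ext x; simp [auxD, SchwartzMap.derivCLM_apply]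

lemma auxD_hasDerivAt (f : SchwartzMap ℝ ℝ) (x : ℝ) : HasDerivAt f (auxD f x) x := by
  rw [auxD_coe]; exact f.differentiableAt.hasDerivAt

lemma auxCorr_deriv {g : ℝ → ℝ} (hg : Continuous g) (hgc : HasCompactSupport g)
    (f : SchwartzMap ℝ ℝ) (x : ℝ) :
    HasDerivAt (auxCorr g f) (auxCorr g (auxD f) x) x := by
  obtain ⟨B, hB⟩ := aux_schwartz_bdd (auxD f)
  have hf : Continuous f := f.continuous
  have hf' : Continuous (auxD f) := (auxD f).continuous
  have hi := hg.integrable_of_hasCompactSupport (μ := volume) hgc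
  refine (hasDerivAt_integral_of_dominated_loc_of_deriv_le (μ := volume) (𝕜 := ℝ)
    (F := fun x v => g v * f (v + x)) (F' := fun x v => g v * auxD f (v + x)) (x₀ := x)
    (s := Set.univ) (bound := fun v => |g v| * B) Filter.univ_mem ?_ ?_ ?_ ?_ ?_ ?_).2
  · exact Filter.Eventually.of_forall fun y => by fun_prop
  · exact Continuous.integrable_of_hasCompactSupport (by fun_prop) (hgc.mul_right)
  · fun_prop
  · refine Filter.Eventually.of_forall fun v y _ => ?_
    rw [norm_mul]
    exact mul_le_mul_of_nonneg_left (hB _) (abs_nonneg _)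
  · exact hi.abs.mul_const B
  · refine Filter.Eventually.of_forall fun v y _ => ?_
    exact ((auxD_hasDerivAt f (v + y)).comp_const_add v y).const_mul (g v)

lemma auxCorr_bdd {g : ℝ → ℝ} (hg : Continuous g) (hgc : HasCompactSupport g)
    (f : SchwartzMap ℝ ℝ) (x : ℝ) :
    |auxCorr g f x| ≤ Real.sqrt (∫ v, g v ^ 2) * Real.sqrt (∫ v, f v ^ 2) := by
  have h1 : MemLp (fun v => f (v + x)) 2 volume :=
    (f.memLp 2).comp_measurePreserving (measurePreserving_add_right volume x)
  have := aux_cs (hg.memLp_of_hasCompactSupport (μ := volume) (p := 2) hgc) h1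
  rwa [integral_add_right_eq_self (fun v => f v ^ 2) x] at this

lemma auxCorr_exp_bdd {g : ℝ → ℝ} (hg : Continuous g) (hgc : HasCompactSupport g)
    (f : SchwartzMap ℝ ℝ) (t : NNReal) :
    |∫ x, auxCorr g f x ∂(gaussianReal 0 t)| ≤
      Real.sqrt (∫ v, g v ^ 2) * Real.sqrt (∫ v, f v ^ 2) := by
  simpa using norm_integral_le_of_norm_le_const (μ := gaussianReal 0 t)
    (f := auxCorr g f) (Filter.Eventually.of_forall (auxCorr_bdd hg hgc f))

lemma auxCorr_exp_diff {g : ℝ → ℝ} (hg : Continuous g) (hgc : HasCompactSupport g)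
    (f : SchwartzMap ℝ ℝ) {s t : ℝ} (hs : 0 ≤ s) (hst : s ≤ t) :
    |∫ x, auxCorr g f x ∂(gaussianReal 0 t.toNNReal) -
      ∫ x, auxCorr g f x ∂(gaussianReal 0 s.toNNReal)| ≤
      (t - s) / 2 * (Real.sqrt (∫ v, g v ^ 2) * Real.sqrt (∫ v, auxD (auxD f) v ^ 2)) := by
  have h : t.toNNReal = s.toNNReal + (t - s).toNNReal := by
    rw [← Real.toNNReal_add hs (by linarith)]; congr 1; ring
  have := aux_gauss (auxCorr_deriv hg hgc f) (auxCorr_deriv hg hgc (auxD f))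
    (auxCorr_bdd hg hgc (auxD (auxD f))) (auxCorr_bdd hg hgc f)
    s.toNNReal (t - s).toNNReal
  rw [← h, Real.coe_toNNReal _ (by linarith)] at this
  exact this

lemma heatK_eq {t : ℝ} (ht : 0 ≤ t) (x : ℝ) : heatK t x = gaussianPDFReal 0 t.toNNReal x := by
  simp [heatK, gaussianPDFReal_def, Real.coe_toNNReal _ ht, div_eq_inv_mul]

lemma heatK_nonneg (t x : ℝ) : 0 ≤ heatK t x := by unfold heatK; positivity

lemma heatK_measurable : Measurable (fun q : ℝ × ℝ => heatK q.1 q.2) := by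
  unfold heatK; fun_prop

lemma heatK_integrable {t : ℝ} (ht : 0 ≤ t) : Integrable (heatK t) := by
  rw [show heatK t = gaussianPDFReal 0 t.toNNReal from funext (heatK_eq ht)]
  exact integrable_gaussianPDFReal _ _

lemma heatK_integral_le {t : ℝ} (ht : 0 ≤ t) : ∫ x, heatK t x ≤ 1 := by
  rcases ht.eq_or_lt with rfl | h
  · simp [heatK]
  · rw [show heatK t = gaussianPDFReal 0 t.toNNReal from funext (heatK_eq ht),
      integral_gaussianPDFReal_eq_one _ (by simpa using h)]

/-- Fubini for the heat semigroup against a Schwartz function. -/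
lemma aux_fubini {g : ℝ → ℝ} (hg : Continuous g) (hgc : HasCompactSupport g)
    (f : SchwartzMap ℝ ℝ) {t : ℝ} (ht : 0 < t) :
    Integrable (fun u => (∫ v, heatK t (u - v) * g v) * f u) ∧
    ∫ u, (∫ v, heatK t (u - v) * g v) * f u =
      ∫ x, auxCorr g f x ∂(gaussianReal 0 t.toNNReal) := by
  obtain ⟨B, hB⟩ := hgc.exists_bound_of_continuous hg
  have hf : Continuous f := f.continuous
  have hm : Measurable (heatK t) := heatK_measurable.comp (measurable_const.prodMk measurable_id)
  have e0 : ∀ u, (∫ v, heatK t (u - v) * g v) * f u = ∫ x, heatK t x * g (u - x) * f u := by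
    intro u
    rw [integral_mul_const]
    congr 1
    have := integral_sub_left_eq_self (fun x => heatK t x * g (u - x)) volume u
    simpa using this
  have hInteg : Integrable (Function.uncurry fun u x : ℝ => heatK t x * g (u - x) * f u)
      (volume.prod volume) := by
    refine Integrable.mono' (((f.integrable (μ := volume)).abs.mul_prod
      (heatK_integrable ht.le)).mul_const B) ?_ ?_
    · refine Measurable.aestronglyMeasurable ?_
      have := hg.measurable
      have := hf.measurable
      unfold Function.uncurry
      fun_prop
    · refine Filter.Eventually.of_forall fun q => ?_
      simp only [Function.uncurry, norm_mul, Real.norm_eq_abs, abs_of_nonneg (heatK_nonneg _ _)]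
      have := mul_le_mul_of_nonneg_left (hB (q.1 - q.2))
        (mul_nonneg (abs_nonneg (f q.1)) (heatK_nonneg t q.2))
      rw [Real.norm_eq_abs] at this
      linarith
  simp_rw [e0]
  refine ⟨hInteg.integral_prod_left, ?_⟩
  rw [integral_integral_swap hInteg, integral_gaussianReal_eq_integral_smul (by simpa using ht)]
  congr 1; ext x
  simp only [smul_eq_mul, ← heatK_eq ht.le, auxCorr, mul_assoc]
  rw [integral_const_mul]
  congr 1
  have := integral_add_right_eq_self (μ := volume) (fun u => g (u - x) * f u) x
  rw [← this]; simp

lemma heatK_hasDerivAt (t x : ℝ) : HasDerivAt (heatK t) (heatK' t x) x := by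
  unfold heatK' heatK
  have := (((hasDerivAt_pow 2 x).neg.div_const (2 * t)).exp).div_const (Real.sqrt (2 * π * t))
  refine this.congr_deriv ?_
  rcases eq_or_ne t 0 with rfl | h
  · simp
  · simp; field_simp

lemma aux_ibp {g g' : ℝ → ℝ} (hg : ∀ x, HasDerivAt g (g' x) x) (hgc : HasCompactSupport g)
    (hg' : Continuous g') (t u : ℝ) :
    ∫ v, heatK' t (u - v) * g v = ∫ v, heatK t (u - v) * g' v := by
  have hgcont : Continuous g := continuous_iff_continuousAt.2 fun x => (hg x).continuousAt
  have hK : Continuous (heatK t) :=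
    continuous_iff_continuousAt.2 fun x => (heatK_hasDerivAt t x).continuousAt
  have hK' : Continuous (heatK' t) := by unfold heatK'; fun_prop
  have hg'c : HasCompactSupport g' := by
    rw [show g' = deriv g from funext fun x => (hg x).deriv.symm]; exact hgc.deriv
  have := integral_mul_deriv_eq_deriv_mul_of_integrable (u := fun v => heatK t (u - v))
    (u' := fun v => -heatK' t (u - v)) (v := g) (v' := g')
    (fun x _ => by simpa using (heatK_hasDerivAt t (u - x)).comp_const_sub u x)
    (fun x _ => hg x)
    (Continuous.integrable_of_hasCompactSupport (by fun_prop) hg'c.mul_left)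
    (Continuous.integrable_of_hasCompactSupport (by fun_prop) hgc.mul_left)
    (Continuous.integrable_of_hasCompactSupport (by fun_prop) hgc.mul_left)
  rw [this, ← integral_neg]
  simp

lemma auxCorr_ibp {g g' : ℝ → ℝ} (hg : ∀ x, HasDerivAt g (g' x) x) (hgc : HasCompactSupport g)
    (hg' : Continuous g') (f : SchwartzMap ℝ ℝ) (x : ℝ) :
    auxCorr g' f x = - auxCorr g (auxD f) x := by
  have hgcont : Continuous g := continuous_iff_continuousAt.2 fun x => (hg x).continuousAt
  have hf : Continuous f := f.continuous
  have hf' : Continuous (auxD f) := (auxD f).continuous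
  have hg'c : HasCompactSupport g' := by
    rw [show g' = deriv g from funext fun x => (hg x).deriv.symm]; exact hgc.deriv
  have := integral_mul_deriv_eq_deriv_mul_of_integrable (u := g)
    (u' := g') (v := fun v => f (v + x)) (v' := fun v => auxD f (v + x))
    (fun x _ => hg x)
    (fun v _ => by simpa using (auxD_hasDerivAt f (v + x)).comp_add_const v x)
    (Continuous.integrable_of_hasCompactSupport (by fun_prop) hgc.mul_right)
    (Continuous.integrable_of_hasCompactSupport (by fun_prop) hg'c.mul_right)
    (Continuous.integrable_of_hasCompactSupport (by fun_prop) hgc.mul_right)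
  unfold auxCorr
  rw [this]; simp

lemma heatK_neg {t : ℝ} (ht : t < 0) (x : ℝ) : heatK t x = 0 := by
  have : Real.sqrt (2 * π * t) = 0 := Real.sqrt_eq_zero_of_nonpos (by
    have := Real.pi_pos
    nlinarith)
  simp [heatK, this]

lemma aux_G_bdd {g : ℝ → ℝ} {B : ℝ} (hB : ∀ v, |g v| ≤ B) (t u : ℝ) :
    |∫ v, heatK t (u - v) * g v| ≤ B := by
  have hB0 : 0 ≤ B := (abs_nonneg _).trans (hB 0)
  rcases lt_or_ge t 0 with ht | ht
  · simpa [heatK_neg ht] using hB0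
  · have hi : Integrable (fun v => heatK t (u - v) * B) :=
      ((heatK_integrable ht).comp_sub_left u).mul_const B
    have := norm_integral_le_of_norm_le (f := fun v => heatK t (u - v) * g v) hi
      (Filter.Eventually.of_forall fun v => by
        rw [norm_mul, Real.norm_eq_abs, Real.norm_eq_abs, abs_of_nonneg (heatK_nonneg _ _)]
        exact mul_le_mul_of_nonneg_left (hB v) (heatK_nonneg _ _))
    refine this.trans ?_
    rw [integral_mul_const, integral_sub_left_eq_self (heatK t) volume u]
    nlinarith [heatK_integral_le ht]

noncomputable def auxA (h : ℝ → ℝ → ℝ) (f : SchwartzMap ℝ ℝ) (t r : ℝ) : ℝ :=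
  ∫ x, auxCorr (h r) (auxD f) x ∂(gaussianReal 0 (t - r).toNNReal)

lemma aux_time {h h' : ℝ → ℝ → ℝ} (hd : ∀ r v, HasDerivAt (h r) (h' r v) v)
    (hc : ∀ r, HasCompactSupport (h r)) (hh' : Continuous fun q : ℝ × ℝ => h' q.1 q.2)
    {B : ℝ} (hB : ∀ r v, |h' r v| ≤ B) (f : SchwartzMap ℝ ℝ) {t : ℝ} (ht : 0 ≤ t) :
    Integrable (fun u => (∫ r in (0:ℝ)..t, ∫ v, heatK' (t - r) (u - v) * h r v) * f u) ∧
    IntervalIntegrable (auxA h f t) volume 0 t ∧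
    ∫ u, (∫ r in (0:ℝ)..t, ∫ v, heatK' (t - r) (u - v) * h r v) * f u =
      - ∫ r in (0:ℝ)..t, auxA h f t r := by
  have hh'r : ∀ r, Continuous (h' r) := fun r =>
    hh'.comp (continuous_const.prodMk continuous_id)
  have hh'c : ∀ r, HasCompactSupport (h' r) := fun r => by
    rw [show h' r = deriv (h r) from funext fun x => (hd r x).deriv.symm]; exact (hc r).deriv
  have e0 : ∀ u r, ∫ v, heatK' (t - r) (u - v) * h r v = ∫ v, heatK (t - r) (u - v) * h' r v :=
    fun u r => aux_ibp (hd r) (hc r) (hh'r r) _ _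
  simp_rw [e0]
  have hf := f.continuous.measurable
  have hm := hh'.measurable
  have hG : StronglyMeasurable (fun q : ℝ × ℝ => ∫ v, heatK (t - q.2) (q.1 - v) * h' q.2 v) := by
    apply StronglyMeasurable.integral_prod_right
    apply Measurable.stronglyMeasurable
    apply Measurable.mul
    · exact heatK_measurable.comp (f := fun p : (ℝ × ℝ) × ℝ => (t - p.1.2, p.1.1 - p.2))
        (by fun_prop)
    · exact hm.comp (f := fun p : (ℝ × ℝ) × ℝ => (p.1.2, p.2)) (by fun_prop)
  have hInteg : Integrable (Function.uncurry fun u r : ℝ =>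
      (∫ v, heatK (t - r) (u - v) * h' r v) * f u)
      (volume.prod (volume.restrict (Set.Ioc 0 t))) := by
    refine Integrable.mono' ((f.integrable (μ := volume)).abs.mul_prod
      (integrable_const B)) ?_ ?_
    · exact (hG.mul (hf.comp measurable_fst).stronglyMeasurable).aestronglyMeasurable
    · refine Filter.Eventually.of_forall fun q => ?_
      simp only [Function.uncurry, norm_mul, Real.norm_eq_abs]
      rw [mul_comm]
      exact mul_le_mul_of_nonneg_left (aux_G_bdd (hB q.2) _ _) (abs_nonneg _)
  have hae : ∀ᵐ r ∂(volume.restrict (Set.Ioc 0 t)),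
      ∫ u, (∫ v, heatK (t - r) (u - v) * h' r v) * f u = - auxA h f t r := by
    rw [ae_restrict_iff' measurableSet_Ioc]
    have hne : ∀ᵐ r ∂(volume : Measure ℝ), r ≠ t := by simp [ae_iff]
    filter_upwards [hne] with r hr hr2
    have hlt : r < t := lt_of_le_of_ne hr2.2 hr
    rw [(aux_fubini (hh'r r) (hh'c r) f (sub_pos.2 hlt)).2, auxA, ← integral_neg]
    congr 1; ext x
    exact auxCorr_ibp (hd r) (hc r) (hh'r r) f x
  have h1 := hInteg.integral_prod_left
  have h2 := hInteg.integral_prod_right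
  have h3 := integral_integral_swap hInteg
  simp only [Function.uncurry] at h1 h2
  have e2 : ∀ u, (∫ r in (0:ℝ)..t, ∫ v, heatK (t - r) (u - v) * h' r v) * f u =
      ∫ r in Set.Ioc 0 t, (∫ v, heatK (t - r) (u - v) * h' r v) * f u := fun u => by
    rw [intervalIntegral.integral_of_le ht]
    exact (integral_mul_const (f u) _).symm
  simp_rw [e2]
  refine ⟨h1, ?_, ?_⟩
  · rw [intervalIntegrable_iff_integrableOn_Ioc_of_le ht]
    refine (h2.congr hae).neg.congr (Filter.Eventually.of_forall fun r => ?_)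
    simp
  · rw [h3, intervalIntegral.integral_of_le ht, ← integral_neg]
    exact integral_congr_ae hae

lemma aux_N {N2 : ℝ → ℝ} (hN : Continuous N2) (h0 : ∀ r, 0 ≤ N2 r) {a b T : ℝ} (ha : 0 ≤ a)
    (hab : a ≤ b) (hb : b ≤ T) :
    ∫ r in a..b, Real.sqrt (N2 r) ≤ Real.sqrt (b - a) * Real.sqrt (∫ r in (0:ℝ)..T, N2 r) := by
  have hs : Continuous fun r => Real.sqrt (N2 r) := hN.sqrt
  have hm : MemLp (fun r => Real.sqrt (N2 r)) 2 (volume.restrict (Set.Ioc a b)) := by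
    rw [memLp_two_iff_integrable_sq hs.aestronglyMeasurable]
    simp_rw [Real.sq_sqrt (h0 _)]
    exact (hN.intervalIntegrable a b).1
  have := aux_cs (memLp_const (1:ℝ) (p := 2) (μ := volume.restrict (Set.Ioc a b))) hm
  simp_rw [Real.sq_sqrt (h0 _), one_mul] at this
  simp_rw [← intervalIntegral.integral_of_le hab] at this
  refine (le_abs_self _).trans (this.trans ?_)
  have e : ∫ _ in a..b, (1:ℝ) ^ 2 = b - a := by simp
  rw [e]
  refine mul_le_mul_of_nonneg_left (Real.sqrt_le_sqrt ?_) (Real.sqrt_nonneg _)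
  exact intervalIntegral.integral_mono_interval ha hab hb
    (Filter.Eventually.of_forall h0) (hN.intervalIntegrable _ _)

end Aux

/-- For every Schwartz function `f` and all `0 ≤ s ≤ t ≤ T`, with
`E = (∫₀ᵀ∫(∂_u H)²)^{1/2}`,
`|∫ (μ(t,u) − μ(s,u)) f(u) du| ≤ ((t−s)/2)‖f''‖₂‖ψ‖₂ + χ√(t−s)‖f'‖₂ E
 + (χ/2)(t−s)√T ‖f'''‖₂ E`. -/
theorem abs_integral_mu_diff_mul_schwartz_le (T ρ χ : ℝ) (hT : 0 < T)
    (hρ : ρ ∈ Set.Ioo (0:ℝ) 1) (hχ : χ = ρ * (1 - ρ))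
    (ψ : ℝ → ℝ) (hψ : ContDiff ℝ 2 ψ) (hψc : HasCompactSupport ψ)
    (H : ℝ → ℝ → ℝ)
    (hH1 : ∀ u, ContDiff ℝ 1 fun t => H t u)
    (hH2 : ∀ t, ContDiff ℝ 2 fun u => H t u)
    (hHt : Continuous fun q : ℝ × ℝ => deriv (fun t => H t q.2) q.1)
    (hHu : Continuous fun q : ℝ × ℝ => deriv (H q.1) q.2)
    (hHuu : Continuous fun q : ℝ × ℝ => deriv (deriv (H q.1)) q.2)
    (hHcont : Continuous fun q : ℝ × ℝ => H q.1 q.2)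
    (hHsupp : HasCompactSupport fun q : ℝ × ℝ => H q.1 q.2)
    (μ : ℝ → ℝ → ℝ)
    (hμ0 : ∀ u, μ 0 u = ψ u)
    (hμ : ∀ t ∈ Set.Ioc (0:ℝ) T, ∀ u, μ t u =
      (∫ v, heatK t (u - v) * ψ v) -
        χ * ∫ r in (0:ℝ)..t, ∫ v, heatK' (t - r) (u - v) * deriv (H r) v) :
    ∀ f : SchwartzMap ℝ ℝ, ∀ s t : ℝ, 0 ≤ s → s ≤ t → t ≤ T →
      |∫ u, (μ t u - μ s u) * f u| ≤
        ((t - s) / 2) * Real.sqrt (∫ u, (deriv (deriv fun x => f x) u) ^ 2) *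
            Real.sqrt (∫ u, (ψ u) ^ 2) +
          χ * Real.sqrt (t - s) * Real.sqrt (∫ u, (deriv (fun x => f x) u) ^ 2) *
            Real.sqrt (∫ r in (0:ℝ)..T, ∫ u, (deriv (H r) u) ^ 2) +
          (χ / 2) * (t - s) * Real.sqrt T *
            Real.sqrt (∫ u, (deriv (deriv (deriv fun x => f x)) u) ^ 2) *
            Real.sqrt (∫ r in (0:ℝ)..T, ∫ u, (deriv (H r) u) ^ 2) := by
  intro f s t hs hst htT
  have hχ0 : 0 ≤ χ := by
    rw [hχ]; exact mul_nonneg hρ.1.le (by linarith [hρ.2])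
  -- support of `H`
  obtain ⟨R, hR⟩ : ∃ R : ℝ, ∀ q : ℝ × ℝ, R < ‖q‖ → H q.1 q.2 = 0 := by
    obtain ⟨R, hR⟩ := hHsupp.isCompact.isBounded.exists_norm_le
    refine ⟨R, fun q hq => ?_⟩
    by_contra hne
    exact absurd (hR q (subset_tsupport _ hne)) (not_le.2 hq)
  have hR1 : ∀ q : ℝ × ℝ, R < ‖q‖ → deriv (H q.1) q.2 = 0 := by
    intro q hq
    have : H q.1 =ᶠ[nhds q.2] fun _ => 0 := by
      have hc : Continuous fun v : ℝ => ‖((q.1, v) : ℝ × ℝ)‖ := by fun_prop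
      filter_upwards [(hc.tendsto q.2).eventually (lt_mem_nhds hq)] with v hv
      exact hR (q.1, v) hv
    rw [this.deriv_eq]; simp
  have hR2 : ∀ q : ℝ × ℝ, R < ‖q‖ → deriv (deriv (H q.1)) q.2 = 0 := by
    intro q hq
    have : deriv (H q.1) =ᶠ[nhds q.2] fun _ => 0 := by
      have hc : Continuous fun v : ℝ => ‖((q.1, v) : ℝ × ℝ)‖ := by fun_prop
      filter_upwards [(hc.tendsto q.2).eventually (lt_mem_nhds hq)] with v hv
      exact hR1 (q.1, v) hv
    rw [this.deriv_eq]; simp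
  have hlt : ∀ r v : ℝ, v ∉ Metric.closedBall (0:ℝ) R → R < ‖((r, v) : ℝ × ℝ)‖ := by
    intro r v hv
    rw [mem_closedBall_zero_iff, not_le] at hv
    exact hv.trans_le (norm_snd_le (r, v))
  have hc : ∀ r, HasCompactSupport (deriv (H r)) := fun r =>
    HasCompactSupport.intro (isCompact_closedBall (0:ℝ) R) fun v hv => hR1 (r, v) (hlt r v hv)
  have hcont : ∀ r, Continuous (deriv (H r)) := fun r =>
    hHu.comp (continuous_const.prodMk continuous_id)
  have hd : ∀ r v, HasDerivAt (deriv (H r)) (deriv (deriv (H r)) v) v := by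
    intro r v
    have h1 : ContDiff ℝ 1 (deriv (H r)) := by
      have := (contDiff_succ_iff_deriv (n := 1) (f := H r)).1 (by simpa [one_add_one_eq_two] using hH2 r)
      exact this.2.2
    exact (h1.differentiable (by simp) v).hasDerivAt
  obtain ⟨B, hB⟩ : ∃ B, ∀ q : ℝ × ℝ, ‖deriv (deriv (H q.1)) q.2‖ ≤ B := by
    refine HasCompactSupport.exists_bound_of_continuous ?_ hHuu
    refine HasCompactSupport.intro (isCompact_closedBall (0:ℝ × ℝ) R) fun q hq => hR2 q ?_
    rwa [mem_closedBall_zero_iff, not_le] at hq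
  have hB' : ∀ r v, |deriv (deriv (H r)) v| ≤ B := fun r v => hB (r, v)
  have hN : Continuous fun r => ∫ u, (deriv (H r) u) ^ 2 := by
    rw [← continuousOn_univ]
    refine continuousOn_integral_of_compact_support (isCompact_closedBall (0:ℝ) R) ?_ ?_
    · exact (hHu.pow 2).continuousOn
    · intro r v _ hv
      simp [hR1 (r, v) (hlt r v hv)]
  have hN0 : ∀ r, 0 ≤ ∫ u, (deriv (H r) u) ^ 2 := fun r => integral_nonneg fun u => sq_nonneg _
  set h : ℝ → ℝ → ℝ := fun r => deriv (H r) with hh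
  have hJ : ∀ t, 0 ≤ t → t ≤ T → Integrable (fun u => μ t u * f u) ∧
      ∫ u, μ t u * f u = ∫ x, auxCorr ψ f x ∂(ProbabilityTheory.gaussianReal 0 t.toNNReal) +
        χ * ∫ r in (0:ℝ)..t, auxA h f t r := by
    intro t ht htT
    rcases ht.eq_or_lt with rfl | ht'
    · simp_rw [hμ0]
      have hf := f.continuous
      have hψ' := hψ.continuous
      refine ⟨Continuous.integrable_of_hasCompactSupport (by fun_prop) hψc.mul_right, ?_⟩
      simp [auxCorr]
    · obtain ⟨i1, i2⟩ := aux_fubini hψ.continuous hψc f ht'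
      obtain ⟨j1, j2, j3⟩ := aux_time hd hc hHuu hB' f ht
      have e : (fun u => μ t u * f u) = fun u => (∫ v, heatK t (u - v) * ψ v) * f u -
          χ * ((∫ r in (0:ℝ)..t, ∫ v, heatK' (t - r) (u - v) * h r v) * f u) := by
        ext u; rw [hμ t ⟨ht', htT⟩ u]; ring
      rw [e]
      refine ⟨i1.sub (j1.const_mul χ), ?_⟩
      rw [integral_sub i1 (j1.const_mul χ), integral_const_mul, i2, j3]
      ring
  have hsT := hst.trans htT
  have ht := hs.trans hst
  obtain ⟨i1, i2⟩ := hJ t ht htT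
  obtain ⟨j1, j2⟩ := hJ s hs hsT
  have ht1 := (aux_time hd hc hHuu hB' f ht).2.1
  have hs1 := (aux_time hd hc hHuu hB' f hs).2.1
  have ht0 : IntervalIntegrable (auxA h f t) volume 0 s :=
    ht1.mono_set (by rw [Set.uIcc_of_le hs, Set.uIcc_of_le ht]; exact Set.Icc_subset_Icc le_rfl hst)
  have hts : IntervalIntegrable (auxA h f t) volume s t :=
    ht1.mono_set (by rw [Set.uIcc_of_le hst, Set.uIcc_of_le ht]; exact Set.Icc_subset_Icc hs le_rfl)
  have e1 : ∫ u, (μ t u - μ s u) * f u =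
      (∫ x, auxCorr ψ f x ∂(ProbabilityTheory.gaussianReal 0 t.toNNReal) -
        ∫ x, auxCorr ψ f x ∂(ProbabilityTheory.gaussianReal 0 s.toNNReal)) +
      χ * (∫ r in s..t, auxA h f t r) +
      χ * (∫ r in (0:ℝ)..s, (auxA h f t r - auxA h f s r)) := by
    simp_rw [sub_mul]
    rw [integral_sub i1 j1, i2, j2, intervalIntegral.integral_sub ht0 hs1,
      ← intervalIntegral.integral_add_adjacent_intervals ht0 hts]
    ring
  have d1 : deriv (fun x => f x) = auxD f := (auxD_coe f).symm
  have d2 : deriv (deriv (fun x => f x)) = auxD (auxD f) := by rw [d1, auxD_coe (auxD f)]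
  have d3 : deriv (deriv (deriv (fun x => f x))) = auxD (auxD (auxD f)) := by
    rw [d2, auxD_coe (auxD (auxD f))]
  rw [d3, d2, d1, e1]
  have b1 := auxCorr_exp_diff hψ.continuous hψc f hs hst
  have hNs : Continuous fun r => Real.sqrt (∫ u, (h r u) ^ 2) := hN.sqrt
  set E := Real.sqrt (∫ r in (0:ℝ)..T, ∫ u, (h r u) ^ 2) with hE
  have hE0 : 0 ≤ E := Real.sqrt_nonneg _
  set F1 := Real.sqrt (∫ u, (auxD f u) ^ 2)
  set F3 := Real.sqrt (∫ u, (auxD (auxD (auxD f)) u) ^ 2)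
  have hF1 : 0 ≤ F1 := Real.sqrt_nonneg _
  have hF3 : 0 ≤ F3 := Real.sqrt_nonneg _
  have b2 : |∫ r in s..t, auxA h f t r| ≤ Real.sqrt (t - s) * E * F1 := by
    have := intervalIntegral.norm_integral_le_of_norm_le (f := auxA h f t) (μ := volume)
      (g := fun r => Real.sqrt (∫ u, (h r u) ^ 2) * F1) hst
      (Filter.Eventually.of_forall fun r _ => auxCorr_exp_bdd (hcont r) (hc r) (auxD f) _)
      ((hNs.mul continuous_const).intervalIntegrable _ _)
    refine this.trans ?_
    rw [intervalIntegral.integral_mul_const]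
    exact mul_le_mul_of_nonneg_right (aux_N hN hN0 hs hst htT) hF1
  have b3 : |∫ r in (0:ℝ)..s, (auxA h f t r - auxA h f s r)| ≤
      (t - s) / 2 * (Real.sqrt T * E * F3) := by
    have := intervalIntegral.norm_integral_le_of_norm_le
      (f := fun r => auxA h f t r - auxA h f s r) (μ := volume)
      (g := fun r => (t - s) / 2 * (Real.sqrt (∫ u, (h r u) ^ 2) * F3)) hs
      (Filter.Eventually.of_forall fun r hr => by
        have := auxCorr_exp_diff (hcont r) (hc r) (auxD f) (s := s - r) (t := t - r)
          (by linarith [hr.2]) (by linarith)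
        rw [show t - r - (s - r) = t - s by ring] at this
        exact this)
      ((continuous_const.mul (hNs.mul continuous_const)).intervalIntegrable _ _)
    refine this.trans ?_
    rw [intervalIntegral.integral_const_mul, intervalIntegral.integral_mul_const]
    refine mul_le_mul_of_nonneg_left (mul_le_mul_of_nonneg_right ?_ hF3) (by linarith)
    refine (aux_N hN hN0 le_rfl hs hsT).trans ?_
    exact mul_le_mul_of_nonneg_right (Real.sqrt_le_sqrt (by linarith)) hE0
  refine (abs_add_three _ _ _).trans ?_
  rw [abs_mul, abs_mul, abs_of_nonneg hχ0]
  have c2 := mul_le_mul_of_nonneg_left b2 hχ0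
  have c3 := mul_le_mul_of_nonneg_left b3 hχ0
  linarith
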